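/- arXiv:2602.18035 — 2 statements merged into one kernel-verified Lean document; each statement's English description precedes it below -/
import Mathlib

section
/- Let N ≥ 1, let Ω₁, Ω₂ ⊂ ℝ^N be disjoint measurable sets, and let u : ℝ^N → ℝ be measurable with u ≥ 0 everywhere and u = 0 almost everywhere in ℝ^N ∖ (Ω₁ ∪ Ω₂). Define ũ : ℝ^N → ℝ by ũ := −u on Ω₁ and ũ := u on ℝ^N ∖ Ω₁. Then for every s ∈ (0,1) the identity [ũ]_s² = [u]_s² + 8 c_{N,s} ∫_{Ω₁} ∫_{Ω₂} u(x) u(y)/|x−y|^{N+2s} dy dx holds in [0,∞]; moreover ‖ũ‖_{L²(ℝ^N)} = ‖u‖_{L²(ℝ^N)}. -/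
open MeasureTheory Filter Topology Classical
open scoped ENNReal

noncomputable def cNs (N : ℕ) (s : ℝ) : ℝ :=
  (2 ^ (2 * s - 1) * Real.Gamma ((N + 2 * s) / 2) * (s * (1 - s))) /
    (Real.pi ^ ((N : ℝ) / 2) * Real.Gamma (2 - s))

/-- Squared Gagliardo seminorm `[u]_s²` for `s ∈ (0,1)`. -/
noncomputable def gagSq (N : ℕ) (u : EuclideanSpace ℝ (Fin N) → ℝ) (s : ℝ) : ℝ≥0∞ :=
  ENNReal.ofReal (cNs N s) *
    ∫⁻ x, ∫⁻ y, ENNReal.ofReal ((u x - u y) ^ 2 / ‖x - y‖ ^ ((N : ℝ) + 2 * s))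

/-- Flipping the sign of `u` on `A` changes the difference quotient only across `A` and `B`. -/
lemma ofReal_sq_sub_neg_on_eq {E : Type*} {A B : Set E} (hAB : Disjoint A B) {u : E → ℝ}
    (hu : ∀ x, 0 ≤ u x) {x y : E} (hx : x ∉ A ∪ B → u x = 0) (hy : y ∉ A ∪ B → u y = 0)
    {k : ℝ} (hk : 0 ≤ k) :
    ENNReal.ofReal (((if x ∈ A then -u x else u x) - (if y ∈ A then -u y else u y)) ^ 2 / k) =
      ENNReal.ofReal ((u x - u y) ^ 2 / k) +
        (A.indicator (fun _ => B.indicator (fun _ => 4 * ENNReal.ofReal (u x * u y / k)) y) x +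
          B.indicator (fun _ => A.indicator (fun _ => 4 * ENNReal.ofReal (u x * u y / k)) y) x) := by
  have cross : ENNReal.ofReal ((u x + u y) ^ 2 / k) =
      ENNReal.ofReal ((u x - u y) ^ 2 / k) + 4 * ENNReal.ofReal (u x * u y / k) := by
    have h4 : (4 : ℝ≥0∞) = ENNReal.ofReal 4 := by norm_num
    rw [h4, ← ENNReal.ofReal_mul (by norm_num), ← ENNReal.ofReal_add (by positivity)
      (mul_nonneg (by norm_num) (div_nonneg (mul_nonneg (hu x) (hu y)) hk))]
    congr 1
    ring
  have hd : ∀ z, z ∈ A → z ∉ B := fun z h h' => Set.disjoint_left.1 hAB h h'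
  by_cases hxA : x ∈ A <;> by_cases hyA : y ∈ A
  · have e : (-u x + u y) ^ 2 = (u x - u y) ^ 2 := by ring
    simp [hxA, hyA, hd x hxA, hd y hyA, e]
  · have e : (-u x - u y) ^ 2 = (u x + u y) ^ 2 := by ring
    by_cases hyB : y ∈ B
    · simp [hxA, hyA, hd x hxA, hyB, e, cross]
    · have hy0 : u y = 0 := hy (by simp [hyA, hyB])
      simp [hxA, hyA, hy0]
  · have e : (u x - -u y) ^ 2 = (u x + u y) ^ 2 := by ring
    by_cases hxB : x ∈ B
    · simp only [hxA, hyA, hxB, hd y hyA, e, cross, if_true, if_false,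
        Set.indicator_of_mem, Set.indicator_of_notMem, not_false_eq_true, zero_add]
    · have hx0 : u x = 0 := hx (by simp [hxA, hxB])
      simp [hyA, hx0]
  · simp [hxA, hyA]

lemma lintegral_indicator_lintegral_indicator {E : Type*} [MeasurableSpace E] {μ : Measure E}
    {A B : Set E} (hA : MeasurableSet A) (hB : MeasurableSet B) (g : E → E → ℝ≥0∞) :
    ∫⁻ x, ∫⁻ y, A.indicator (fun _ => B.indicator (fun _ => g x y) y) x ∂μ ∂μ =
      ∫⁻ x in A, ∫⁻ y in B, g x y ∂μ ∂μ := by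
  rw [← lintegral_indicator hA]
  refine lintegral_congr fun x => ?_
  by_cases hx : x ∈ A
  · simp only [hx, Set.indicator_of_mem]
    exact lintegral_indicator hB (g x)
  · simp [hx]

lemma measurable_indicator_indicator {E : Type*} [MeasurableSpace E] {A B : Set E}
    (hA : MeasurableSet A) (hB : MeasurableSet B) {g : E → E → ℝ≥0∞}
    (hg : Measurable (Function.uncurry g)) :
    Measurable fun z : E × E =>
      A.indicator (fun _ => B.indicator (fun _ => g z.1 z.2) z.2) z.1 := by
  have h := hg.indicator (hA.prod hB)
  convert h using 2 with z
  by_cases h1 : z.1 ∈ A <;> by_cases h2 : z.2 ∈ B <;> simp [h1, h2, Function.uncurry]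

lemma setLIntegral_swap_of_symm {E : Type*} [MeasurableSpace E] {μ : Measure E} [SFinite μ]
    {g : E → E → ℝ≥0∞} (hg : Measurable (Function.uncurry g)) (hsymm : ∀ x y, g x y = g y x)
    (A B : Set E) :
    ∫⁻ x in B, ∫⁻ y in A, g x y ∂μ ∂μ = ∫⁻ x in A, ∫⁻ y in B, g x y ∂μ ∂μ := by
  rw [lintegral_lintegral_swap hg.aemeasurable]
  simp_rw [hsymm]

/-- The effect of a sign flip on a Gagliardo-type double integral with symmetric kernel `1 / k`. -/
lemma lintegral_sq_sub_neg_on_eq {E : Type*} [MeasurableSpace E] {μ : Measure E} [SFinite μ]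
    {A B : Set E} (hA : MeasurableSet A) (hB : MeasurableSet B) (hAB : Disjoint A B)
    {u : E → ℝ} (hum : Measurable u) (hu : ∀ x, 0 ≤ u x)
    (hzero : ∀ᵐ x ∂μ, x ∉ A ∪ B → u x = 0) {k : E → E → ℝ}
    (hkm : Measurable (Function.uncurry k)) (hk0 : ∀ x y, 0 ≤ k x y)
    (hk_symm : ∀ x y, k x y = k y x) :
    ∫⁻ x, ∫⁻ y, ENNReal.ofReal (((if x ∈ A then -u x else u x) -
        (if y ∈ A then -u y else u y)) ^ 2 / k x y) ∂μ ∂μ =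
      (∫⁻ x, ∫⁻ y, ENNReal.ofReal ((u x - u y) ^ 2 / k x y) ∂μ ∂μ) +
        8 * ∫⁻ x in A, ∫⁻ y in B, ENNReal.ofReal (u x * u y / k x y) ∂μ ∂μ := by
  have hum1 : Measurable fun z : E × E => u z.1 := hum.comp measurable_fst
  have hum2 : Measurable fun z : E × E => u z.2 := hum.comp measurable_snd
  have hFm : Measurable fun z : E × E => ENNReal.ofReal ((u z.1 - u z.2) ^ 2 / k z.1 z.2) :=
    (((hum1.sub hum2).pow_const 2).div hkm).ennreal_ofReal
  have hgm : Measurable (Function.uncurry fun x y => 4 * ENNReal.ofReal (u x * u y / k x y)) :=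
    ((hum1.mul hum2).div hkm).ennreal_ofReal.const_mul 4
  have hg_symm : ∀ x y, 4 * ENNReal.ofReal (u x * u y / k x y) =
      4 * ENNReal.ofReal (u y * u x / k y x) := fun x y => by
    rw [hk_symm x y, mul_comm (u x)]
  have hIm := measurable_indicator_indicator hA hB hgm
  trans ∫⁻ x, ((∫⁻ y, ENNReal.ofReal ((u x - u y) ^ 2 / k x y) ∂μ) +
      ((∫⁻ y, A.indicator (fun _ => B.indicator
          (fun _ => 4 * ENNReal.ofReal (u x * u y / k x y)) y) x ∂μ) +
        ∫⁻ y, B.indicator (fun _ => A.indicator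
          (fun _ => 4 * ENNReal.ofReal (u x * u y / k x y)) y) x ∂μ)) ∂μ
  · apply lintegral_congr_ae
    filter_upwards [hzero] with x hx
    have hFx : Measurable fun y => ENNReal.ofReal ((u x - u y) ^ 2 / k x y) :=
      (hFm.comp (measurable_prodMk_left (x := x)) :)
    have hIx : Measurable fun y => A.indicator (fun _ => B.indicator
        (fun _ => 4 * ENNReal.ofReal (u x * u y / k x y)) y) x :=
      (hIm.comp (measurable_prodMk_left (x := x)) :)
    rw [← lintegral_add_left hIx, ← lintegral_add_left hFx]
    apply lintegral_congr_ae
    filter_upwards [hzero] with y hy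
    exact ofReal_sq_sub_neg_on_eq hAB hu hx hy (hk0 x y)
  · rw [lintegral_add_left hFm.lintegral_prod_right',
      lintegral_add_left hIm.lintegral_prod_right',
      lintegral_indicator_lintegral_indicator hA hB,
      lintegral_indicator_lintegral_indicator hB hA,
      setLIntegral_swap_of_symm hgm hg_symm A B]
    simp_rw [lintegral_const_mul' (4 : ℝ≥0∞) _ (by norm_num : (4 : ℝ≥0∞) ≠ ∞)]
    rw [← add_mul]
    norm_num

theorem stmt12 (N : ℕ) (hN : 1 ≤ N) (Ω₁ Ω₂ : Set (EuclideanSpace ℝ (Fin N)))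
    (h1m : MeasurableSet Ω₁) (h2m : MeasurableSet Ω₂) (hdisj : Disjoint Ω₁ Ω₂)
    (u : EuclideanSpace ℝ (Fin N) → ℝ) (hum : Measurable u) (hnn : ∀ x, 0 ≤ u x)
    (hzero : ∀ᵐ x, x ∉ Ω₁ ∪ Ω₂ → u x = 0) :
    (∀ s ∈ Set.Ioo (0 : ℝ) 1,
      gagSq N (fun x => if x ∈ Ω₁ then -u x else u x) s =
        gagSq N u s + ENNReal.ofReal (8 * cNs N s) *
          ∫⁻ x in Ω₁, ∫⁻ y in Ω₂,
            ENNReal.ofReal (u x * u y / ‖x - y‖ ^ ((N : ℝ) + 2 * s))) ∧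
    eLpNorm (fun x => if x ∈ Ω₁ then -u x else u x) 2 volume = eLpNorm u 2 volume := by
  refine ⟨fun s _ => ?_, eLpNorm_congr_norm_ae (.of_forall fun x => ?_)⟩
  · have hkm : Measurable (Function.uncurry fun x y : EuclideanSpace ℝ (Fin N) =>
        ‖x - y‖ ^ ((N : ℝ) + 2 * s)) :=
      (measurable_fst.sub measurable_snd).norm.pow_const _
    have h8 : ENNReal.ofReal (8 * cNs N s) = ENNReal.ofReal (cNs N s) * 8 := by
      rw [ENNReal.ofReal_mul (by norm_num), mul_comm]
      norm_num
    unfold gagSq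
    rw [h8, mul_assoc, ← mul_add, ← lintegral_sq_sub_neg_on_eq h1m h2m hdisj hum hnn hzero hkm
      (fun x y => by positivity) (fun x y => by rw [norm_sub_rev])]
  · split_ifs <;> simp
end

section
/- Let N ≥ 1, s ∈ (0,1), and let u₁, u₂ : ℝ^N → ℝ be measurable functions with [u₁]_s < ∞, [u₂]_s < ∞ and u₁(x) u₂(x) = 0 for almost every x ∈ ℝ^N. Then the integrand (u₁(x)−u₁(y))(u₂(x)−u₂(y))/|x−y|^{N+2s} is absolutely integrable over ℝ^N × ℝ^N and ⟨u₁,u₂⟩_s := c_{N,s} ∫_{ℝ^N}∫_{ℝ^N} (u₁(x)−u₁(y))(u₂(x)−u₂(y))/|x−y|^{N+2s} dx dy = −2 c_{N,s} ∫_{ℝ^N}∫_{ℝ^N} u₁(x) u₂(y)/|x−y|^{N+2s} dx dy. If moreover u₁ ≥ 0 and u₂ ≥ 0 almost everywhere and each of u₁, u₂ is nonzero on a set of positive Lebesgue measure, then ⟨u₁,u₂⟩_s < 0. -/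
open MeasureTheory Filter Topology
open scoped ENNReal

lemma cNs_pos (N : ℕ) {s : ℝ} (hs : s ∈ Set.Ioo (0 : ℝ) 1) : 0 < cNs N s := by
  obtain ⟨h0, h1⟩ := hs
  have hΓ₁ : 0 < Real.Gamma ((N + 2 * s) / 2) := Real.Gamma_pos_of_pos (by positivity)
  have hΓ₂ : 0 < Real.Gamma (2 - s) := Real.Gamma_pos_of_pos (by linarith)
  have h1s : 0 < 1 - s := by linarith
  unfold cNs
  positivity

lemma integrable_sq_sub_div_of_gagSq_lt_top {N : ℕ} {s : ℝ} (hs : s ∈ Set.Ioo (0 : ℝ) 1)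
    {u : EuclideanSpace ℝ (Fin N) → ℝ} (hu : Measurable u) (hfin : gagSq N u s < ⊤) :
    Integrable (fun q : EuclideanSpace ℝ (Fin N) × EuclideanSpace ℝ (Fin N) =>
      (u q.1 - u q.2) ^ 2 / ‖q.1 - q.2‖ ^ ((N : ℝ) + 2 * s)) := by
  have hmeas : Measurable (fun q : EuclideanSpace ℝ (Fin N) × EuclideanSpace ℝ (Fin N) =>
      (u q.1 - u q.2) ^ 2 / ‖q.1 - q.2‖ ^ ((N : ℝ) + 2 * s)) := by fun_prop
  have hc : ENNReal.ofReal (cNs N s) ≠ 0 := by simpa using cNs_pos N hs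
  refine (lintegral_ofReal_ne_top_iff_integrable hmeas.aestronglyMeasurable
    (ae_of_all _ fun q => by positivity)).1 ?_
  rw [Measure.volume_eq_prod, lintegral_prod _ hmeas.ennreal_ofReal.aemeasurable]
  intro htop
  rw [gagSq, htop, ENNReal.mul_top hc] at hfin
  exact lt_irrefl _ hfin

/-- The mixed Gagliardo integrand is integrable, by Young's inequality. -/
lemma integrable_mul_sub_div_of_gagSq_lt_top {N : ℕ} {s : ℝ} (hs : s ∈ Set.Ioo (0 : ℝ) 1)
    {u₁ u₂ : EuclideanSpace ℝ (Fin N) → ℝ} (h1m : Measurable u₁) (h2m : Measurable u₂)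
    (h1fin : gagSq N u₁ s < ⊤) (h2fin : gagSq N u₂ s < ⊤) :
    Integrable (fun q : EuclideanSpace ℝ (Fin N) × EuclideanSpace ℝ (Fin N) =>
      (u₁ q.1 - u₁ q.2) * (u₂ q.1 - u₂ q.2) / ‖q.1 - q.2‖ ^ ((N : ℝ) + 2 * s)) := by
  refine ((integrable_sq_sub_div_of_gagSq_lt_top hs h1m h1fin).add
    (integrable_sq_sub_div_of_gagSq_lt_top hs h2m h2fin)).mono'
    (Measurable.aestronglyMeasurable (by fun_prop)) (ae_of_all _ fun q => ?_)
  have hw : 0 ≤ ‖q.1 - q.2‖ ^ ((N : ℝ) + 2 * s) := by positivity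
  rw [Pi.add_apply, ← add_div, Real.norm_eq_abs, abs_div, abs_of_nonneg hw]
  gcongr
  rw [abs_le]
  constructor <;>
    nlinarith [sq_nonneg (u₁ q.1 - u₁ q.2 + (u₂ q.1 - u₂ q.2)),
      sq_nonneg (u₁ q.1 - u₁ q.2 - (u₂ q.1 - u₂ q.2)),
      sq_nonneg (u₁ q.1 - u₁ q.2), sq_nonneg (u₂ q.1 - u₂ q.2)]

/-- A property that holds almost everywhere holds at both coordinates of almost every pair. -/
lemma ae_prod_and_of_ae {α : Type*} [MeasurableSpace α] {μ : Measure α} [SFinite μ]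
    {p : α → Prop} (h : ∀ᵐ x ∂μ, p x) : ∀ᵐ q ∂μ.prod μ, p q.1 ∧ p q.2 :=
  (Measure.quasiMeasurePreserving_fst.ae h).and (Measure.quasiMeasurePreserving_snd.ae h)

theorem stmt13 (N : ℕ) (hN : 1 ≤ N) (s : ℝ) (hs : s ∈ Set.Ioo (0 : ℝ) 1)
    (u₁ u₂ : EuclideanSpace ℝ (Fin N) → ℝ) (h1m : Measurable u₁) (h2m : Measurable u₂)
    (h1fin : gagSq N u₁ s < ⊤) (h2fin : gagSq N u₂ s < ⊤)
    (horth : ∀ᵐ x, u₁ x * u₂ x = 0) :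
    Integrable (fun q : EuclideanSpace ℝ (Fin N) × EuclideanSpace ℝ (Fin N) =>
      (u₁ q.1 - u₁ q.2) * (u₂ q.1 - u₂ q.2) / ‖q.1 - q.2‖ ^ ((N : ℝ) + 2 * s)) ∧
    cNs N s * ∫ x, ∫ y, (u₁ x - u₁ y) * (u₂ x - u₂ y) / ‖x - y‖ ^ ((N : ℝ) + 2 * s) =
      -2 * cNs N s * ∫ x, ∫ y, u₁ x * u₂ y / ‖x - y‖ ^ ((N : ℝ) + 2 * s) ∧
    ((∀ᵐ x, 0 ≤ u₁ x) → (∀ᵐ x, 0 ≤ u₂ x) →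
      0 < volume {x | u₁ x ≠ 0} → 0 < volume {x | u₂ x ≠ 0} →
      cNs N s * ∫ x, ∫ y, (u₁ x - u₁ y) * (u₂ x - u₂ y) / ‖x - y‖ ^ ((N : ℝ) + 2 * s) < 0) := by
  have hF := integrable_mul_sub_div_of_gagSq_lt_top hs h1m h2m h1fin h2fin
  have hae := ae_prod_and_of_ae horth
  have hG : Integrable (fun q : EuclideanSpace ℝ (Fin N) × EuclideanSpace ℝ (Fin N) =>
      u₁ q.1 * u₂ q.2 / ‖q.1 - q.2‖ ^ ((N : ℝ) + 2 * s)) := by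
    refine hF.mono (Measurable.aestronglyMeasurable (by fun_prop)) ?_
    filter_upwards [hae] with q ⟨hx, hy⟩
    by_cases h : u₁ q.1 * u₂ q.2 = 0
    · simpa [h] using by positivity
    · obtain ⟨ha, hb⟩ := mul_ne_zero_iff.1 h
      have hx' : u₂ q.1 = 0 := (mul_eq_zero.1 hx).resolve_left ha
      have hy' : u₁ q.2 = 0 := (mul_eq_zero.1 hy).resolve_right hb
      simp [hx', hy']
  rw [Measure.volume_eq_prod] at hF hG ⊢
  have hsum : ∫ x, ∫ y, (u₁ x - u₁ y) * (u₂ x - u₂ y) / ‖x - y‖ ^ ((N : ℝ) + 2 * s) =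
      -2 * ∫ x, ∫ y, u₁ x * u₂ y / ‖x - y‖ ^ ((N : ℝ) + 2 * s) := by
    rw [← integral_prod _ hF, ← integral_prod _ hG]
    have hswap := integral_prod_swap (μ := (volume : Measure (EuclideanSpace ℝ (Fin N))))
      (ν := (volume : Measure (EuclideanSpace ℝ (Fin N))))
      (fun q => u₁ q.1 * u₂ q.2 / ‖q.1 - q.2‖ ^ ((N : ℝ) + 2 * s))
    calc _ = ∫ q : EuclideanSpace ℝ (Fin N) × EuclideanSpace ℝ (Fin N),
          (-(u₁ q.1 * u₂ q.2 / ‖q.1 - q.2‖ ^ ((N : ℝ) + 2 * s)) -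
            u₁ q.swap.1 * u₂ q.swap.2 / ‖q.swap.1 - q.swap.2‖ ^ ((N : ℝ) + 2 * s)) := by
          refine integral_congr_ae ?_
          filter_upwards [hae] with q ⟨hx, hy⟩
          rw [Prod.fst_swap, Prod.snd_swap, norm_sub_rev q.2 q.1, ← neg_div, ← sub_div]
          congr 1
          linear_combination hx + hy
      _ = _ := by
          have hsub := integral_sub hG.neg hG.swap
          simp only [Pi.neg_apply, Function.comp_apply, integral_neg, hswap] at hsub
          rw [Measure.volume_eq_prod, hsub]
          ring
  refine ⟨hF, by rw [hsum]; ring, fun h1 h2 hp1 hp2 => ?_⟩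
  have hpos : 0 < ∫ x, ∫ y, u₁ x * u₂ y / ‖x - y‖ ^ ((N : ℝ) + 2 * s) := by
    rw [← integral_prod _ hG, integral_pos_iff_support_of_nonneg_ae ?_ hG]
    · have hA : volume {x | u₁ x ≠ 0 ∧ u₂ x = 0} = volume {x | u₁ x ≠ 0} := by
        refine measure_congr ?_
        filter_upwards [horth] with x hx
        exact propext ⟨fun h => h.1, fun h => ⟨h, (mul_eq_zero.1 hx).resolve_left h⟩⟩
      have hAB : 0 < (volume.prod volume)
          ({x | u₁ x ≠ 0 ∧ u₂ x = 0} ×ˢ {x | u₂ x ≠ 0}) := by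
        rw [Measure.prod_prod, hA]
        exact ENNReal.mul_pos hp1.ne' hp2.ne'
      refine hAB.trans_le (measure_mono ?_)
      rintro ⟨x, y⟩ ⟨⟨hx, hx'⟩, hy⟩
      have hxy : x ≠ y := by
        rintro rfl
        exact hy hx'
      exact div_ne_zero (mul_ne_zero hx hy)
        (Real.rpow_pos_of_pos (norm_sub_pos_iff.2 hxy) _).ne'
    · filter_upwards [ae_prod_and_of_ae h1, ae_prod_and_of_ae h2] with q h1q h2q
      exact div_nonneg (mul_nonneg h1q.1 h2q.2) (by positivity)
  rw [hsum]
  nlinarith [mul_pos (cNs_pos N hs) hpos]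
end
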